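/- For every integer k ≥ 1 and all indices A₁, …, A_k, B, C ∈ {1,…,n} (here A₁, …, A_k label indices of the hatted frame), the following identities hold on Ω (sums over repeated capital indices from 1 to n): L_C̄( Σ_D γ^D_B·(ĥ_{Ā₁…Ā_k D} ∘ f) ) = Σ_{H,I} γ^H_B·conj(γ^I_C)·(ĥ_{Ā₁…Ā_k Ī H} ∘ f) − Σ_{H,I} γ^H_B·conj(γ^I_C)·((ĥ_{Ā₁…Ā_k}·ĥ_{ĪH}) ∘ f) − Σ_H η^H·(ĥ_{Ā₁…Ā_k H} ∘ f)·h_{C̄B}; and L_C̄( Σ_D η^D·(ĥ_{Ā₁…Ā_k D} ∘ f) ) = Σ_{H,I} η^H·conj(γ^I_C)·(ĥ_{Ā₁…Ā_k Ī H} ∘ f) − Σ_{H,I} η^H·conj(γ^I_C)·((ĥ_{Ā₁…Ā_k}·ĥ_{ĪH}) ∘ f) − Σ_H η^H·(ĥ_{Ā₁…Ā_k H} ∘ f)·h_C̄. -/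

import Mathlib

open scoped Topology

noncomputable section

/-- A complex vector field on (an open subset of) `ℝ^m`, given by its components:
it acts on functions by `(Xu)(x) = Du(x)·X(x)`. -/
abbrev VF (m : ℕ) := (Fin m → ℝ) → Fin m → ℂ

/-- The action `(Xu)(x) = Du(x)·X(x)` of a complex vector field on a function. -/
noncomputable def vapp {m : ℕ} (X : VF m) (u : (Fin m → ℝ) → ℂ) (x : Fin m → ℝ) : ℂ :=
  ∑ i, X x i * fderiv ℝ u x (Pi.single i 1)

/-- The Lie bracket `[X,Y](x) = DY(x)·X(x) − DX(x)·Y(x)` of complex vector fields. -/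
noncomputable def vbrk {m : ℕ} (X Y : VF m) : VF m :=
  fun x j => vapp X (fun y => Y y j) x - vapp Y (fun y => X y j) x

/-- The componentwise complex conjugate `X̄` of a complex vector field. -/
def vconj {m : ℕ} (X : VF m) : VF m := fun x i => (starRingEnd ℂ) (X x i)

/-- A normalized frame (Lemma 1.33): `T, L_A, L_Ā` is a smooth pointwise basis of `ℂ^{2n+1}`
on `Ω` with `T` real, `[L_A, L_B] = 0`, `[L_Ā, L_B] = −h_{ĀB}·T`, `[L_Ā, T] = −h_Ā·T`, and
each `[L_A, T]` a smooth multiple of `T`.  The fields `lv` and `hb` are the Levi functions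
`h_{ĀB}` and `h_Ā`. -/
structure NFrame (n : ℕ) (Ω : Set (Fin (2 * n + 1) → ℝ)) (T : VF (2 * n + 1))
    (L : Fin n → VF (2 * n + 1))
    (lv : Fin n → Fin n → (Fin (2 * n + 1) → ℝ) → ℂ)
    (hb : Fin n → (Fin (2 * n + 1) → ℝ) → ℂ) : Prop where
  open_Ω : IsOpen Ω
  mem0 : (0 : Fin (2 * n + 1) → ℝ) ∈ Ω
  smoothT : ContDiffOn ℝ (⊤ : ℕ∞) T Ω
  smoothL : ∀ A, ContDiffOn ℝ (⊤ : ℕ∞) (L A) Ω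
  smooth_lv : ∀ A B, ContDiffOn ℝ (⊤ : ℕ∞) (lv A B) Ω
  smooth_hb : ∀ A, ContDiffOn ℝ (⊤ : ℕ∞) (hb A) Ω
  Treal : ∀ x i, (starRingEnd ℂ) (T x i) = T x i
  indep : ∀ x ∈ Ω, LinearIndependent ℂ
    (Sum.elim (fun _ : Fin 1 => T x) (Sum.elim (fun A => L A x) (fun A => vconj (L A) x)))
  spans : ∀ x ∈ Ω, Submodule.span ℂ
    (Set.range (Sum.elim (fun _ : Fin 1 => T x)
      (Sum.elim (fun A => L A x) (fun A => vconj (L A) x)))) = ⊤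
  commLL : ∀ A B, ∀ x ∈ Ω, vbrk (L A) (L B) x = 0
  commLbL : ∀ A B, ∀ x ∈ Ω, vbrk (vconj (L A)) (L B) x = fun i => -(lv A B x) * T x i
  commLbT : ∀ A, ∀ x ∈ Ω, vbrk (vconj (L A)) T x = fun i => -(hb A x) * T x i
  commLT : ∀ A, ∃ c : (Fin (2 * n + 1) → ℝ) → ℂ, ContDiffOn ℝ (⊤ : ℕ∞) c Ω ∧
    ∀ x ∈ Ω, vbrk (L A) T x = fun i => c x * T x i

/-- Auxiliary: the iterated Levi function `h_{Ā₁…Ā_k}` (`T`-component), with the index list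
given in *reverse* order `[A_k,…,A₁]`, defined by the recursion
`h_{Ās C̄} = L_C̄ h_{Ās} + h_{Ās}·h_C̄`. -/
noncomputable def hTrev {n : ℕ} (L : Fin n → VF (2 * n + 1))
    (hb : Fin n → (Fin (2 * n + 1) → ℝ) → ℂ) :
    List (Fin n) → (Fin (2 * n + 1) → ℝ) → ℂ
  | [] => fun _ => 1
  | [C] => hb C
  | C :: rest => fun x =>
      vapp (vconj (L C)) (hTrev L hb rest) x + hTrev L hb rest x * hb C x

/-- Auxiliary: the iterated Levi function `h_{Ā₁…Ā_k D}`, with the index list given in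
*reverse* order `[A_k,…,A₁]`, defined by the recursion
`h_{Ās C̄ D} = L_C̄ h_{Ās D} + h_{Ās}·h_{C̄D}`. -/
noncomputable def hDrev {n : ℕ} (L : Fin n → VF (2 * n + 1))
    (lv : Fin n → Fin n → (Fin (2 * n + 1) → ℝ) → ℂ)
    (hb : Fin n → (Fin (2 * n + 1) → ℝ) → ℂ) :
    List (Fin n) → Fin n → (Fin (2 * n + 1) → ℝ) → ℂ
  | [], _ => fun _ => 0
  | [C], D => lv C D
  | C :: rest, D => fun x =>
      vapp (vconj (L C)) (hDrev L lv hb rest D) x + hTrev L hb rest x * lv C D x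

/-- The iterated Levi function `h_{Ā₁…Ā_k D}`, for `As = [A₁,…,A_k]`. -/
noncomputable def hIt {n : ℕ} (L : Fin n → VF (2 * n + 1))
    (lv : Fin n → Fin n → (Fin (2 * n + 1) → ℝ) → ℂ)
    (hb : Fin n → (Fin (2 * n + 1) → ℝ) → ℂ)
    (As : List (Fin n)) (D : Fin n) : (Fin (2 * n + 1) → ℝ) → ℂ :=
  hDrev L lv hb As.reverse D

/-- The iterated Levi function `h_{Ā₁…Ā_k}`, for `As = [A₁,…,A_k]`. -/
noncomputable def hTIt {n : ℕ} (L : Fin n → VF (2 * n + 1))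
    (hb : Fin n → (Fin (2 * n + 1) → ℝ) → ℂ)
    (As : List (Fin n)) : (Fin (2 * n + 1) → ℝ) → ℂ :=
  hTrev L hb As.reverse

/-- The data of a CR diffeomorphism `f : Ω → Ω̂` expressed in two normalized frames
(Context 10/11/12): `Df·L_B = Σ γ^A_B L̂_A`, `Df·L_B̄ = Σ conj(γ^A_B) L̂_Ā`,
`Df·T = ξ T̂ + Σ η^A L̂_A + Σ conj(η^A) L̂_Ā`, with `(γ^A_B)` pointwise invertible,
`ξ` real valued, and `f` a smooth diffeomorphism with `f(0) = 0`. -/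
structure CRTrans (n : ℕ) (Ω Ωh : Set (Fin (2 * n + 1) → ℝ))
    (T : VF (2 * n + 1)) (L : Fin n → VF (2 * n + 1))
    (Th : VF (2 * n + 1)) (Lh : Fin n → VF (2 * n + 1))
    (f : (Fin (2 * n + 1) → ℝ) → (Fin (2 * n + 1) → ℝ))
    (γ : Fin n → Fin n → (Fin (2 * n + 1) → ℝ) → ℂ)
    (η : Fin n → (Fin (2 * n + 1) → ℝ) → ℂ)
    (ξ : (Fin (2 * n + 1) → ℝ) → ℝ) : Prop where
  smooth_f : ContDiffOn ℝ (⊤ : ℕ∞) f Ω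
  maps : Set.MapsTo f Ω Ωh
  f0 : f 0 = 0
  diffeo : ∃ g, ContDiffOn ℝ (⊤ : ℕ∞) g Ωh ∧ Set.MapsTo g Ωh Ω ∧
    (∀ x ∈ Ω, g (f x) = x) ∧ ∀ y ∈ Ωh, f (g y) = y
  smooth_γ : ∀ A B, ContDiffOn ℝ (⊤ : ℕ∞) (γ A B) Ω
  smooth_η : ∀ A, ContDiffOn ℝ (⊤ : ℕ∞) (η A) Ω
  smooth_ξ : ContDiffOn ℝ (⊤ : ℕ∞) ξ Ω
  γ_inv : ∀ x ∈ Ω, IsUnit (Matrix.of fun A B => γ A B x)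
  pushL : ∀ B, ∀ x ∈ Ω, ∀ j, vapp (L B) (fun y => ((f y j : ℝ) : ℂ)) x =
    ∑ A, γ A B x * Lh A (f x) j
  pushLb : ∀ B, ∀ x ∈ Ω, ∀ j, vapp (vconj (L B)) (fun y => ((f y j : ℝ) : ℂ)) x =
    ∑ A, (starRingEnd ℂ) (γ A B x) * vconj (Lh A) (f x) j
  pushT : ∀ x ∈ Ω, ∀ j, vapp T (fun y => ((f y j : ℝ) : ℂ)) x =
    (ξ x : ℂ) * Th (f x) j + (∑ A, η A x * Lh A (f x) j)
      + ∑ A, (starRingEnd ℂ) (η A x) * vconj (Lh A) (f x) j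

lemma vapp_congr {m : ℕ} (X : VF m) {u v : (Fin m → ℝ) → ℂ} {x : Fin m → ℝ}
    (h : u =ᶠ[𝓝 x] v) : vapp X u x = vapp X v x := by
  simp only [vapp, h.fderiv_eq]

lemma vapp_mul {m : ℕ} (X : VF m) {u v : (Fin m → ℝ) → ℂ} {x : Fin m → ℝ}
    (hu : DifferentiableAt ℝ u x) (hv : DifferentiableAt ℝ v x) :
    vapp X (fun y => u y * v y) x = vapp X u x * v x + u x * vapp X v x := by
  simp only [vapp, fderiv_fun_mul hu hv, Finset.sum_mul, Finset.mul_sum, ← Finset.sum_add_distrib]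
  refine Finset.sum_congr rfl fun i _ => ?_
  simp
  ring

lemma vapp_sum {m : ℕ} {ι : Type*} [Fintype ι] (X : VF m) {u : ι → (Fin m → ℝ) → ℂ}
    {x : Fin m → ℝ} (hu : ∀ a, DifferentiableAt ℝ (u a) x) :
    vapp X (fun y => ∑ a, u a y) x = ∑ a, vapp X (u a) x := by
  simp only [vapp]
  rw [fderiv_fun_sum (fun a _ => hu a), Finset.sum_comm]
  simp [Finset.mul_sum]

lemma vapp_conj {m : ℕ} (X : VF m) (u : (Fin m → ℝ) → ℂ) (x : Fin m → ℝ) :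
    vapp (vconj X) (fun y => (starRingEnd ℂ) (u y)) x = (starRingEnd ℂ) (vapp X u x) := by
  have h : fderiv ℝ (fun y => (starRingEnd ℂ) (u y)) x
      = (Complex.conjCLE : ℂ →L[ℝ] ℂ).comp (fderiv ℝ u x) :=
    Complex.conjCLE.comp_fderiv (f := u) (x := x)
  simp only [vapp, h, vconj, map_sum, map_mul]
  rfl

lemma vbrk_conj {m : ℕ} (X Y : VF m) (x : Fin m → ℝ) :
    vbrk (vconj X) (vconj Y) x = vconj (vbrk X Y) x := by
  funext j
  have h1 := vapp_conj X (fun y => Y y j) x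
  have h2 := vapp_conj Y (fun y => X y j) x
  simp only [vbrk, vconj, map_sub] at *
  rw [← h1, ← h2]

lemma vbrk_swap {m : ℕ} (X Y : VF m) (x : Fin m → ℝ) : vbrk X Y x = - vbrk Y X x := by
  funext j
  simp [vbrk]

lemma vbrk_self {m : ℕ} (X : VF m) (x : Fin m → ℝ) : vbrk X X x = 0 := by
  funext j
  simp [vbrk]

lemma clm_expand {m : ℕ} {E : Type*} [NormedAddCommGroup E] [NormedSpace ℝ E]
    (l : (Fin m → ℝ) →L[ℝ] E) (v : Fin m → ℝ) : l v = ∑ j, v j • l (Pi.single j 1) := by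
  conv_lhs => rw [pi_eq_sum_univ' v]
  simp [map_sum, map_smul]

lemma vapp_comp {m : ℕ} (X : VF m) {u : (Fin m → ℝ) → ℂ} {f : (Fin m → ℝ) → (Fin m → ℝ)}
    {x : Fin m → ℝ} (hu : DifferentiableAt ℝ u (f x)) (hf : DifferentiableAt ℝ f x) :
    vapp X (fun y => u (f y)) x =
      ∑ j, vapp X (fun y => ((f y j : ℝ) : ℂ)) x * fderiv ℝ u (f x) (Pi.single j 1) := by
  have h1 : fderiv ℝ (fun y => u (f y)) x = (fderiv ℝ u (f x)).comp (fderiv ℝ f x) :=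
    fderiv_comp x hu hf
  have h2 : ∀ j v, fderiv ℝ (fun y => ((f y j : ℝ) : ℂ)) x v = ((fderiv ℝ f x v j : ℝ) : ℂ) := by
    intro j v
    have a : HasFDerivAt (fun y => f y j) ((ContinuousLinearMap.proj j).comp (fderiv ℝ f x)) x :=
      (hasFDerivAt_pi'.1 hf.hasFDerivAt) j
    have b := (Complex.ofRealCLM.hasFDerivAt (x := f x j)).comp x a
    have c : HasFDerivAt (fun y => ((f y j : ℝ) : ℂ)) _ x := b
    rw [c.fderiv]
    rfl
  simp only [vapp, h1, h2, Finset.sum_mul]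
  rw [Finset.sum_comm]
  refine Finset.sum_congr rfl fun i _ => ?_
  rw [ContinuousLinearMap.comp_apply, clm_expand (fderiv ℝ u (f x)), Finset.mul_sum]
  refine Finset.sum_congr rfl fun j _ => ?_
  rw [Complex.real_smul]
  ring

lemma vapp_push {m : ℕ} {ι : Type*} [Fintype ι] (X : VF m) (W : ι → VF m) (p : ι → ℂ)
    {u : (Fin m → ℝ) → ℂ} {f : (Fin m → ℝ) → (Fin m → ℝ)}
    {x : Fin m → ℝ} (hu : DifferentiableAt ℝ u (f x)) (hf : DifferentiableAt ℝ f x)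
    (hp : ∀ j, vapp X (fun y => ((f y j : ℝ) : ℂ)) x = ∑ a, p a * W a (f x) j) :
    vapp X (fun y => u (f y)) x = ∑ a, p a * vapp (W a) u (f x) := by
  rw [vapp_comp X hu hf]
  simp only [hp]
  simp only [vapp, Finset.sum_mul, Finset.mul_sum]
  rw [Finset.sum_comm]
  refine Finset.sum_congr rfl fun i _ => Finset.sum_congr rfl fun j _ => ?_
  ring

lemma vapp_vapp {m : ℕ} (X Y : VF m) {u : (Fin m → ℝ) → ℂ} {x : Fin m → ℝ}
    (hY : ∀ i, DifferentiableAt ℝ (fun y => Y y i) x)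
    (hu : DifferentiableAt ℝ (fderiv ℝ u) x) :
    vapp X (vapp Y u) x = (∑ i, vapp X (fun y => Y y i) x * fderiv ℝ u x (Pi.single i 1))
      + ∑ i, ∑ k, Y x i * X x k * fderiv ℝ (fderiv ℝ u) x (Pi.single k 1) (Pi.single i 1) := by
  have e : ∀ i, HasFDerivAt (fun y => fderiv ℝ u y (Pi.single i 1))
      ((fderiv ℝ (fderiv ℝ u) x).flip (Pi.single i 1)) x := by
    intro i
    have := hu.hasFDerivAt.clm_apply (hasFDerivAt_const (Pi.single i (1:ℝ)) x)
    simpa using this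
  have d : ∀ i, DifferentiableAt ℝ (fun y => fderiv ℝ u y (Pi.single i 1)) x :=
    fun i => (e i).differentiableAt
  have : vapp Y u = fun y => ∑ i, Y y i * fderiv ℝ u y (Pi.single i 1) := rfl
  rw [this, vapp_sum X (fun i => (hY i).fun_mul (d i)), ← Finset.sum_add_distrib]
  refine Finset.sum_congr rfl fun i _ => ?_
  rw [vapp_mul X (hY i) (d i)]
  congr 1
  simp only [vapp, (e i).fderiv, Finset.mul_sum]
  refine Finset.sum_congr rfl fun k _ => ?_
  simp
  ring

lemma vapp_vbrk {m : ℕ} (X Y : VF m) {u : (Fin m → ℝ) → ℂ} {x : Fin m → ℝ}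
    (hX : ∀ i, DifferentiableAt ℝ (fun y => X y i) x)
    (hY : ∀ i, DifferentiableAt ℝ (fun y => Y y i) x)
    (hu : ContDiffAt ℝ (⊤ : ℕ∞) u x) :
    vapp (vbrk X Y) u x = vapp X (vapp Y u) x - vapp Y (vapp X u) x := by
  have h2 : (2 : WithTop ℕ∞) ≤ ((⊤ : ℕ∞) : WithTop ℕ∞) := by
    exact WithTop.coe_le_coe.2 (le_top : (2 : ℕ∞) ≤ ⊤)
  have hd : DifferentiableAt ℝ (fderiv ℝ u) x :=
    (hu.fderiv_right (m := 1) (by rw [one_add_one_eq_two]; exact h2)).differentiableAt (by simp)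
  have hs : IsSymmSndFDerivAt ℝ u x := hu.isSymmSndFDerivAt (by simpa using h2)
  rw [vapp_vapp X Y hY hd, vapp_vapp Y X hX hd]
  have : (∑ i, ∑ k, Y x i * X x k * fderiv ℝ (fderiv ℝ u) x (Pi.single k 1) (Pi.single i 1))
      = ∑ i, ∑ k, X x i * Y x k * fderiv ℝ (fderiv ℝ u) x (Pi.single k 1) (Pi.single i 1) := by
    rw [Finset.sum_comm]
    refine Finset.sum_congr rfl fun i _ => Finset.sum_congr rfl fun k _ => ?_
    rw [hs.eq (Pi.single i 1) (Pi.single k 1)]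
    ring
  rw [this, add_sub_add_right_eq_sub, ← Finset.sum_sub_distrib]
  refine Finset.sum_congr rfl fun i _ => ?_
  simp only [vbrk]
  ring

lemma push_vbrk {m : ℕ} {ι : Type*} [Fintype ι] (X Y : VF m) (W : ι → VF m)
    (p q : ι → (Fin m → ℝ) → ℂ) {f : (Fin m → ℝ) → (Fin m → ℝ)} {x : Fin m → ℝ}
    (hX : ∀ i, DifferentiableAt ℝ (fun y => X y i) x)
    (hY : ∀ i, DifferentiableAt ℝ (fun y => Y y i) x)
    (hW : ∀ a i, DifferentiableAt ℝ (fun y => W a y i) (f x))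
    (hf : ContDiffAt ℝ (⊤ : ℕ∞) f x)
    (hp : ∀ a, DifferentiableAt ℝ (p a) x) (hq : ∀ a, DifferentiableAt ℝ (q a) x)
    (hXp : ∀ᶠ y in 𝓝 x, ∀ j, vapp X (fun y => ((f y j : ℝ) : ℂ)) y = ∑ a, p a y * W a (f y) j)
    (hYq : ∀ᶠ y in 𝓝 x, ∀ j, vapp Y (fun y => ((f y j : ℝ) : ℂ)) y = ∑ a, q a y * W a (f y) j)
    (j : Fin m) :
    vapp (vbrk X Y) (fun y => ((f y j : ℝ) : ℂ)) x =
      (∑ a, (vapp X (q a) x - vapp Y (p a) x) * W a (f x) j)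
      + ∑ a, ∑ b, p a x * q b x * vbrk (W a) (W b) (f x) j := by
  have hfd : DifferentiableAt ℝ f x := hf.differentiableAt (by simp)
  have hfj : ContDiffAt ℝ (⊤ : ℕ∞) (fun y => ((f y j : ℝ) : ℂ)) x :=
    Complex.ofRealCLM.contDiff.contDiffAt.comp x (contDiffAt_pi.1 hf j)
  have hWf : ∀ a, DifferentiableAt ℝ (fun y => W a (f y) j) x := fun a =>
    DifferentiableAt.comp (g := fun y => W a y j) x (hW a j) hfd
  have key : ∀ (X Y : VF m) (p q : ι → (Fin m → ℝ) → ℂ),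
      (∀ a, DifferentiableAt ℝ (q a) x) →
      (∀ᶠ y in 𝓝 x, ∀ j, vapp X (fun y => ((f y j : ℝ) : ℂ)) y = ∑ a, p a y * W a (f y) j) →
      (∀ᶠ y in 𝓝 x, ∀ j, vapp Y (fun y => ((f y j : ℝ) : ℂ)) y = ∑ a, q a y * W a (f y) j) →
      vapp X (vapp Y (fun y => ((f y j : ℝ) : ℂ))) x = (∑ a, vapp X (q a) x * W a (f x) j)
        + ∑ a, ∑ b, p a x * q b x * vapp (W a) (fun y => W b y j) (f x) := by
    intro X Y p q hq hXp hYq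
    have e : vapp Y (fun y => ((f y j : ℝ) : ℂ)) =ᶠ[𝓝 x] fun y => ∑ a, q a y * W a (f y) j := by
      filter_upwards [hYq] with y hy using hy j
    rw [vapp_congr X e, vapp_sum X (fun a => (hq a).fun_mul (hWf a)), Finset.sum_comm,
      ← Finset.sum_add_distrib]
    refine Finset.sum_congr rfl fun b _ => ?_
    rw [vapp_mul X (hq b) (hWf b)]
    congr 1
    rw [vapp_push X W (fun a => p a x) (u := fun y => W b y j) (hW b j) hfd hXp.self_of_nhds,
      Finset.mul_sum]
    refine Finset.sum_congr rfl fun a _ => ?_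
    ring
  rw [vapp_vbrk X Y hX hY hfj, key X Y p q hq hXp hYq, key Y X q p hp hYq hXp]
  simp only [vbrk, mul_sub, sub_mul, Finset.sum_sub_distrib]
  rw [Finset.sum_comm (f := fun a b => p a x * q b x * vapp (W b) (fun y => W a y j) (f x))]
  have : ∀ a b, q a x * p b x = p b x * q a x := fun a b => mul_comm _ _
  simp only [this]
  ring

/-- the full frame as a family -/
def fr {n : ℕ} (T : VF (2 * n + 1)) (L : Fin n → VF (2 * n + 1)) :
    Fin 1 ⊕ (Fin n ⊕ Fin n) → VF (2 * n + 1) :=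
  Sum.elim (fun _ => T) (Sum.elim L (fun A => vconj (L A)))

lemma fr_brk {n : ℕ} {Ω : Set (Fin (2 * n + 1) → ℝ)} {T : VF (2 * n + 1)}
    {L : Fin n → VF (2 * n + 1)} {lv hb} (hF : NFrame n Ω T L lv hb) {y} (hy : y ∈ Ω) (a b) :
    ∃ c : ℂ, vbrk (fr T L a) (fr T L b) y = c • T y := by
  have hTT : vconj T = T := by
    funext x i; exact hF.Treal x i
  have sw : ∀ X Y : VF (2 * n + 1), (∃ c : ℂ, vbrk X Y y = c • T y) →
      ∃ c : ℂ, vbrk Y X y = c • T y := by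
    rintro X Y ⟨c, hc⟩
    exact ⟨-c, by rw [vbrk_swap, hc, neg_smul]⟩
  have h1 : ∀ A, ∃ c : ℂ, vbrk (L A) T y = c • T y := fun A => by
    obtain ⟨c, _, hc⟩ := hF.commLT A
    exact ⟨c y, hc y hy⟩
  have h2 : ∀ A, ∃ c : ℂ, vbrk (vconj (L A)) T y = c • T y := fun A =>
    ⟨_, hF.commLbT A y hy⟩
  have h3 : ∀ A B, ∃ c : ℂ, vbrk (vconj (L A)) (L B) y = c • T y := fun A B =>
    ⟨_, hF.commLbL A B y hy⟩
  rcases a with a | a | a <;> rcases b with b | b | b <;> simp only [fr, Sum.elim_inl, Sum.elim_inr]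
  · exact ⟨0, by rw [vbrk_self]; simp⟩
  · exact sw _ _ (h1 _)
  · exact sw _ _ (h2 _)
  · exact h1 _
  · exact ⟨0, by rw [hF.commLL a b y hy]; simp⟩
  · exact sw _ _ (h3 _ _)
  · exact h2 _
  · exact h3 _ _
  · refine ⟨0, ?_⟩
    rw [vbrk_conj]
    funext i
    simp [vconj, hF.commLL a b y hy]

lemma conj_diff {m : ℕ} {u : (Fin m → ℝ) → ℂ} {x} (h : DifferentiableAt ℝ u x) :
    DifferentiableAt ℝ (fun y => (starRingEnd ℂ) (u y)) x :=
  Complex.conjCLE.differentiableAt.comp x h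

lemma comp_diff {m : ℕ} {X : VF m} {Ω : Set (Fin m → ℝ)} (ho : IsOpen Ω)
    (hX : ContDiffOn ℝ (⊤ : ℕ∞) X Ω) {x} (hx : x ∈ Ω) (i) :
    DifferentiableAt ℝ (fun y => X y i) x :=
  differentiableAt_pi.1 ((hX.contDiffAt (ho.mem_nhds hx)).differentiableAt (by simp)) i

lemma fr_diff {n : ℕ} {Ω : Set (Fin (2 * n + 1) → ℝ)} {T : VF (2 * n + 1)}
    {L : Fin n → VF (2 * n + 1)} {lv hb} (hF : NFrame n Ω T L lv hb) {y} (hy : y ∈ Ω) (a i) :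
    DifferentiableAt ℝ (fun z => fr T L a z i) y := by
  rcases a with a | a | a
  · exact comp_diff hF.open_Ω hF.smoothT hy i
  · exact comp_diff hF.open_Ω (hF.smoothL a) hy i
  · exact conj_diff (comp_diff hF.open_Ω (hF.smoothL a) hy i)

lemma coef_eq {n : ℕ} {Ω Ωh : Set (Fin (2 * n + 1) → ℝ)}
    {Th : VF (2 * n + 1)} {Lh : Fin n → VF (2 * n + 1)} {lvh hbh}
    (hFh : NFrame n Ωh Th Lh lvh hbh) (ho : IsOpen Ω) {f} (hf : ContDiffOn ℝ (⊤ : ℕ∞) f Ω)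
    (hm : Set.MapsTo f Ω Ωh) (X Y T : VF (2 * n + 1))
    (p q t : Fin 1 ⊕ (Fin n ⊕ Fin n) → (Fin (2 * n + 1) → ℝ) → ℂ) {x} (hx : x ∈ Ω)
    (hX : ∀ i, DifferentiableAt ℝ (fun y => X y i) x)
    (hY : ∀ i, DifferentiableAt ℝ (fun y => Y y i) x)
    (hp : ∀ a, DifferentiableAt ℝ (p a) x) (hq : ∀ a, DifferentiableAt ℝ (q a) x)
    (hXp : ∀ y ∈ Ω, ∀ j, vapp X (fun y => ((f y j : ℝ) : ℂ)) y = ∑ a, p a y * fr Th Lh a (f y) j)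
    (hYq : ∀ y ∈ Ω, ∀ j, vapp Y (fun y => ((f y j : ℝ) : ℂ)) y = ∑ a, q a y * fr Th Lh a (f y) j)
    (hTt : ∀ y ∈ Ω, ∀ j, vapp T (fun y => ((f y j : ℝ) : ℂ)) y = ∑ a, t a y * fr Th Lh a (f y) j)
    (c : ℂ) (hc : vbrk X Y x = fun i => -c * T x i) (D : Fin n) :
    vapp X (q (Sum.inr (Sum.inl D))) x - vapp Y (p (Sum.inr (Sum.inl D))) x
      = -c * t (Sum.inr (Sum.inl D)) x := by
  have hN := ho.mem_nhds hx
  have hfx := hm hx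
  have hb := push_vbrk X Y (fr Th Lh) p q hX hY (fr_diff hFh hfx) (hf.contDiffAt hN) hp hq
    (by filter_upwards [hN] with y hy using hXp y hy)
    (by filter_upwards [hN] with y hy using hYq y hy)
  have hT : ∀ j, vapp (vbrk X Y) (fun y => ((f y j : ℝ) : ℂ)) x
      = -c * ∑ a, t a x * fr Th Lh a (f x) j := by
    intro j
    rw [← hTt x hx j]
    simp only [vapp, hc, Finset.mul_sum, mul_assoc]
  choose k hk using fr_brk hFh hfx
  have hli : LinearIndependent ℂ (fun a => fr Th Lh a (f x)) := by
    convert hFh.indep (f x) hfx using 1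
    funext a
    rcases a with a | a | a <;> rfl
  set K : ℂ := ∑ a, ∑ b, p a x * q b x * k a b with hK
  have hfin := Fintype.linearIndependent_iff.1 hli
    (fun a => vapp X (q a) x - vapp Y (p a) x + c * t a x + if a = Sum.inl 0 then K else 0) (by
      funext j
      have e := (hb j).symm.trans (hT j)
      simp only [hk] at e
      simp only [Finset.sum_apply, Pi.smul_apply, smul_eq_mul, add_mul, Finset.sum_add_distrib,
        ite_mul, zero_mul, Finset.sum_ite_eq', Finset.mem_univ, if_true, Pi.zero_apply] at e ⊢
      have e2 : ∑ a, ∑ b, p a x * q b x * (k a b * Th (f x) j) = K * Th (f x) j := by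
        simp only [hK, Finset.sum_mul, mul_assoc]
      rw [e2] at e
      have e3 : fr Th Lh (Sum.inl 0) (f x) j = Th (f x) j := rfl
      rw [e3]
      simp only [Finset.mul_sum, ← mul_assoc, neg_mul, Finset.sum_neg_distrib] at e
      linear_combination e)
    (Sum.inr (Sum.inl D))
  simp at hfin
  linear_combination hfin

lemma vapp_smooth {m : ℕ} {X : VF m} {u : (Fin m → ℝ) → ℂ} {Ω : Set (Fin m → ℝ)} (ho : IsOpen Ω)
    (hX : ContDiffOn ℝ (⊤ : ℕ∞) X Ω) (hu : ContDiffOn ℝ (⊤ : ℕ∞) u Ω) :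
    ContDiffOn ℝ (⊤ : ℕ∞) (vapp X u) Ω := by
  have h := hu.fderiv_of_isOpen (m := (⊤ : ℕ∞)) ho (by simp)
  refine ContDiffOn.sum fun i _ => ?_
  exact (contDiffOn_pi.1 hX i).mul (h.clm_apply contDiffOn_const)

lemma vconj_smooth {m : ℕ} {X : VF m} {Ω : Set (Fin m → ℝ)}
    (hX : ContDiffOn ℝ (⊤ : ℕ∞) X Ω) : ContDiffOn ℝ (⊤ : ℕ∞) (vconj X) Ω :=
  contDiffOn_pi.2 fun i => Complex.conjCLE.contDiff.comp_contDiffOn (contDiffOn_pi.1 hX i)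

lemma hTrev_smooth {n : ℕ} {Ω : Set (Fin (2 * n + 1) → ℝ)} {T : VF (2 * n + 1)}
    {L : Fin n → VF (2 * n + 1)} {lv hb} (hF : NFrame n Ω T L lv hb) :
    ∀ l, ContDiffOn ℝ (⊤ : ℕ∞) (hTrev L hb l) Ω
  | [] => contDiffOn_const
  | [C] => hF.smooth_hb C
  | C :: D :: r => by
    have ih := hTrev_smooth hF (D :: r)
    exact (vapp_smooth hF.open_Ω (vconj_smooth (hF.smoothL C)) ih).add (ih.mul (hF.smooth_hb C))

lemma hDrev_smooth {n : ℕ} {Ω : Set (Fin (2 * n + 1) → ℝ)} {T : VF (2 * n + 1)}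
    {L : Fin n → VF (2 * n + 1)} {lv hb} (hF : NFrame n Ω T L lv hb) (B : Fin n) :
    ∀ l, ContDiffOn ℝ (⊤ : ℕ∞) (hDrev L lv hb l B) Ω
  | [] => contDiffOn_const
  | [C] => hF.smooth_lv C B
  | C :: D :: r => by
    have ih := hDrev_smooth hF B (D :: r)
    exact (vapp_smooth hF.open_Ω (vconj_smooth (hF.smoothL C)) ih).add
      ((hTrev_smooth hF (D :: r)).mul (hF.smooth_lv C B))

lemma hIt_append {n : ℕ} (L : Fin n → VF (2 * n + 1)) (lv hb)
    (As : List (Fin n)) (h : 1 ≤ As.length) (I H : Fin n) (y) :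
    hIt L lv hb (As ++ [I]) H y =
      vapp (vconj (L I)) (hIt L lv hb As H) y + hTIt L hb As y * lv I H y := by
  have h' : As.reverse ≠ [] := by
    intro e
    simp at e
    simp [e] at h
  simp only [hIt, hTIt, List.reverse_append, List.reverse_singleton, List.singleton_append]
  obtain ⟨a, r, e⟩ := List.exists_cons_of_ne_nil h'
  rw [e]
  rfl

/-- Lemma 2.14.  For `k ≥ 1` and hatted indices `As = [A₁,…,A_k]`, the
two differentiation identities for `L_C̄(Σ_D γ^D_B·(ĥ_{Ā₁…Ā_k D}∘f))` and
`L_C̄(Σ_D η^D·(ĥ_{Ā₁…Ā_k D}∘f))` hold on `Ω`. -/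
theorem statement11 (n : ℕ) (hn : 1 ≤ n)
    (Ω Ωh : Set (Fin (2 * n + 1) → ℝ))
    (T : VF (2 * n + 1)) (L : Fin n → VF (2 * n + 1))
    (lv : Fin n → Fin n → (Fin (2 * n + 1) → ℝ) → ℂ)
    (hb : Fin n → (Fin (2 * n + 1) → ℝ) → ℂ)
    (Th : VF (2 * n + 1)) (Lh : Fin n → VF (2 * n + 1))
    (lvh : Fin n → Fin n → (Fin (2 * n + 1) → ℝ) → ℂ)
    (hbh : Fin n → (Fin (2 * n + 1) → ℝ) → ℂ)
    (hF : NFrame n Ω T L lv hb) (hFh : NFrame n Ωh Th Lh lvh hbh)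
    (f : (Fin (2 * n + 1) → ℝ) → (Fin (2 * n + 1) → ℝ))
    (γ : Fin n → Fin n → (Fin (2 * n + 1) → ℝ) → ℂ)
    (η : Fin n → (Fin (2 * n + 1) → ℝ) → ℂ)
    (ξ : (Fin (2 * n + 1) → ℝ) → ℝ)
    (htr : CRTrans n Ω Ωh T L Th Lh f γ η ξ) :
    ∀ (As : List (Fin n)), 1 ≤ As.length → ∀ (B C : Fin n), ∀ x ∈ Ω,
      (vapp (vconj (L C)) (fun y => ∑ D, γ D B y * hIt Lh lvh hbh As D (f y)) x =
        (∑ H, ∑ I, γ H B x * (starRingEnd ℂ) (γ I C x) * hIt Lh lvh hbh (As ++ [I]) H (f x))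
          - (∑ H, ∑ I, γ H B x * (starRingEnd ℂ) (γ I C x) *
              (hTIt Lh hbh As (f x) * lvh I H (f x)))
          - (∑ H, η H x * hIt Lh lvh hbh As H (f x) * lv C B x)) ∧
      (vapp (vconj (L C)) (fun y => ∑ D, η D y * hIt Lh lvh hbh As D (f y)) x =
        (∑ H, ∑ I, η H x * (starRingEnd ℂ) (γ I C x) * hIt Lh lvh hbh (As ++ [I]) H (f x))
          - (∑ H, ∑ I, η H x * (starRingEnd ℂ) (γ I C x) *
              (hTIt Lh hbh As (f x) * lvh I H (f x)))
          - (∑ H, η H x * hIt Lh lvh hbh As H (f x) * hb C x)) := by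
  have hof := hF.open_Ω
  have hmem : ∀ x ∈ Ω, Ω ∈ 𝓝 x := fun x hx => hof.mem_nhds hx
  have hγ : ∀ x ∈ Ω, ∀ A B, DifferentiableAt ℝ (γ A B) x := fun x hx A B =>
    ((htr.smooth_γ A B).contDiffAt (hmem x hx)).differentiableAt (by simp)
  have hη : ∀ x ∈ Ω, ∀ A, DifferentiableAt ℝ (η A) x := fun x hx A =>
    ((htr.smooth_η A).contDiffAt (hmem x hx)).differentiableAt (by simp)
  have hξ : ∀ x ∈ Ω, DifferentiableAt ℝ (fun y => (ξ y : ℂ)) x := fun x hx =>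
    Complex.ofRealCLM.differentiableAt.comp x
      ((htr.smooth_ξ.contDiffAt (hmem x hx)).differentiableAt (by simp))
  let pLb : Fin n → Fin 1 ⊕ (Fin n ⊕ Fin n) → (Fin (2 * n + 1) → ℝ) → ℂ := fun B =>
    Sum.elim (fun _ _ => 0) (Sum.elim (fun _ _ => 0) (fun A y => (starRingEnd ℂ) (γ A B y)))
  let pL : Fin n → Fin 1 ⊕ (Fin n ⊕ Fin n) → (Fin (2 * n + 1) → ℝ) → ℂ := fun B =>
    Sum.elim (fun _ _ => 0) (Sum.elim (fun A => γ A B) (fun _ _ => 0))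
  let pT : Fin 1 ⊕ (Fin n ⊕ Fin n) → (Fin (2 * n + 1) → ℝ) → ℂ :=
    Sum.elim (fun _ y => (ξ y : ℂ)) (Sum.elim η (fun A y => (starRingEnd ℂ) (η A y)))
  have hpLb : ∀ B, ∀ y ∈ Ω, ∀ j, vapp (vconj (L B)) (fun y => ((f y j : ℝ) : ℂ)) y
      = ∑ a, pLb B a y * fr Th Lh a (f y) j := by
    intro B y hy j
    rw [htr.pushLb B y hy j]
    simp [pLb, fr, Fintype.sum_sum_type]
  have hpL : ∀ B, ∀ y ∈ Ω, ∀ j, vapp (L B) (fun y => ((f y j : ℝ) : ℂ)) y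
      = ∑ a, pL B a y * fr Th Lh a (f y) j := by
    intro B y hy j
    rw [htr.pushL B y hy j]
    simp [pL, fr, Fintype.sum_sum_type]
  have hpT : ∀ y ∈ Ω, ∀ j, vapp T (fun y => ((f y j : ℝ) : ℂ)) y
      = ∑ a, pT a y * fr Th Lh a (f y) j := by
    intro y hy j
    rw [htr.pushT y hy j]
    simp [pT, fr, Fintype.sum_sum_type, add_assoc]
  have dLb : ∀ x ∈ Ω, ∀ B a, DifferentiableAt ℝ (pLb B a) x := by
    intro x hx B a
    rcases a with a | a | a
    · exact differentiableAt_const _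
    · exact differentiableAt_const _
    · exact conj_diff (hγ x hx a B)
  have dL : ∀ x ∈ Ω, ∀ B a, DifferentiableAt ℝ (pL B a) x := by
    intro x hx B a
    rcases a with a | a | a
    · exact differentiableAt_const _
    · exact hγ x hx a B
    · exact differentiableAt_const _
  have dT : ∀ x ∈ Ω, ∀ a, DifferentiableAt ℝ (pT a) x := by
    intro x hx a
    rcases a with a | a | a
    · exact hξ x hx
    · exact hη x hx a
    · exact conj_diff (hη x hx a)
  have v0 : ∀ (X : VF (2 * n + 1)) x, vapp X (fun _ => 0) x = 0 := by
    intro X x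
    simp [vapp]
  have Dγ : ∀ x ∈ Ω, ∀ B C D, vapp (vconj (L C)) (γ D B) x = - lv C B x * η D x := by
    intro x hx B C D
    have := coef_eq hFh hof htr.smooth_f htr.maps (vconj (L C)) (L B) T (pLb C) (pL B) pT hx
      (fun i => conj_diff (comp_diff hof (hF.smoothL C) hx i)) (comp_diff hof (hF.smoothL B) hx)
      (dLb x hx C) (dL x hx B) (hpLb C) (hpL B) hpT (lv C B x) (hF.commLbL C B x hx) D
    simpa [pLb, pL, pT, v0] using this
  have Dη : ∀ x ∈ Ω, ∀ C D, vapp (vconj (L C)) (η D) x = - hb C x * η D x := by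
    intro x hx C D
    have := coef_eq hFh hof htr.smooth_f htr.maps (vconj (L C)) T T (pLb C) pT pT hx
      (fun i => conj_diff (comp_diff hof (hF.smoothL C) hx i)) (comp_diff hof hF.smoothT hx)
      (dLb x hx C) (dT x hx) (hpLb C) hpT hpT (hb C x) (hF.commLbT C x hx) D
    simpa [pLb, pT, v0] using this
  intro As hAs B C x hx
  have hfd : DifferentiableAt ℝ f x :=
    (htr.smooth_f.contDiffAt (hmem x hx)).differentiableAt (by simp)
  have hh : ∀ D, DifferentiableAt ℝ (hIt Lh lvh hbh As D) (f x) := fun D =>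
    ((hDrev_smooth hFh D As.reverse).contDiffAt
      (hFh.open_Ω.mem_nhds (htr.maps hx))).differentiableAt (by simp)
  have hhf : ∀ D, DifferentiableAt ℝ (fun y => hIt Lh lvh hbh As D (f y)) x := fun D =>
    (hh D).comp x hfd
  have gen : ∀ (g : Fin n → (Fin (2 * n + 1) → ℝ) → ℂ) (c : ℂ),
      (∀ D, DifferentiableAt ℝ (g D) x) →
      (∀ D, vapp (vconj (L C)) (g D) x = - c * η D x) →
      vapp (vconj (L C)) (fun y => ∑ D, g D y * hIt Lh lvh hbh As D (f y)) x =
        (∑ H, ∑ I, g H x * (starRingEnd ℂ) (γ I C x) * hIt Lh lvh hbh (As ++ [I]) H (f x))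
          - (∑ H, ∑ I, g H x * (starRingEnd ℂ) (γ I C x) *
              (hTIt Lh hbh As (f x) * lvh I H (f x)))
          - (∑ H, η H x * hIt Lh lvh hbh As H (f x) * c) := by
    intro g c hg hgc
    rw [vapp_sum _ (fun D => (hg D).fun_mul (hhf D)), ← Finset.sum_sub_distrib,
      ← Finset.sum_sub_distrib]
    refine Finset.sum_congr rfl fun D _ => ?_
    rw [vapp_mul _ (hg D) (hhf D), hgc,
      vapp_push (vconj (L C)) (fun A => vconj (Lh A)) (fun A => (starRingEnd ℂ) (γ A C x))
        (hh D) hfd (htr.pushLb C x hx), ← Finset.sum_sub_distrib, Finset.mul_sum]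
    have : ∀ I, g D x * (starRingEnd ℂ) (γ I C x) * hIt Lh lvh hbh (As ++ [I]) D (f x)
        - g D x * (starRingEnd ℂ) (γ I C x) * (hTIt Lh hbh As (f x) * lvh I D (f x))
        = g D x * ((starRingEnd ℂ) (γ I C x) *
          vapp (vconj (Lh I)) (hIt Lh lvh hbh As D) (f x)) := by
      intro I
      rw [hIt_append Lh lvh hbh As hAs]
      ring
    simp only [this]
    ring
  exact ⟨gen (fun D => γ D B) (lv C B x) (fun D => hγ x hx D B) (fun D => Dγ x hx B C D),
    gen η (hb C x) (fun D => hη x hx D) (fun D => Dη x hx C D)⟩
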